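/- Let p(t) = t² + 4t and let u ∈ ℂ((t⁻¹)) be the expansion of √(p(t)) at infinity (u = ∑_{i≥0} λ_i 4^i t^{1-i}). Then the linear map from the abstract three-point Witt algebra W_p (with basis d_n, e_n, n ∈ ℤ) into the Lie algebra of derivations of ℂ((t⁻¹)) sending d_n ↦ -p(t) t^{n+1} d/dt and e_n ↦ -u t^{n+1} d/dt is an injective Lie algebra homomorphism. -/

import Mathlib

noncomputable def lam (n : ℕ) : ℂ :=
  (∏ k ∈ Finset.range n, ((1 : ℂ) / 2 - k)) / n.factorial

/-- We model ℂ((t⁻¹)) as formal Laurent series in s = t⁻¹ (so t^k ↦ s^{-k}).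
A derivation f(t) d/dt of ℂ((t⁻¹)) is recorded by the coefficient series of
the corresponding vector field F(s) d/ds, where F(s) = -s² f(1/s)
(since d/dt = -s² d/ds); the Lie bracket of F d/ds and G d/ds is
(F G' - G F') d/ds, with ' = d/ds implemented by `lderiv`. -/
noncomputable def lderiv (F : LaurentSeries ℂ) : LaurentSeries ℂ where
  coeff k := (k + 1 : ℤ) • F.coeff (k + 1)
  isPWO_support' := by
    have h : (Function.support fun k : ℤ => (k + 1 : ℤ) • F.coeff (k + 1)) ⊆
        (fun k : ℤ => k - 1) '' F.support := by
      intro k hk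
      simp only [Function.mem_support] at hk
      refine ⟨k + 1, ?_, by ring⟩
      simp only [HahnSeries.mem_support]
      intro h0
      apply hk
      rw [h0, smul_zero]
    exact (F.isPWO_support.image_of_monotone (fun a b hab => by omega)).mono h

/-- u = ∑_{i≥0} λ_i 4^i t^{1-i}, the expansion of √(t²+4t) at infinity,
written in the variable s = t⁻¹. -/
noncomputable def uInf : LaurentSeries ℂ :=
  HahnSeries.single (-1 : ℤ) (1 : ℂ) *
    HahnSeries.ofPowerSeries ℤ ℂ (PowerSeries.mk fun i => lam i * 4 ^ i)

/-- The three-point Witt algebra W_p: free ℂ-vector space on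
{d_n, e_n : n ∈ ℤ}, with `Sum.inl n` ↦ d_n and `Sum.inr n` ↦ e_n. -/
abbrev Wp : Type := (ℤ ⊕ ℤ) →₀ ℂ

noncomputable def db (n : ℤ) : Wp := Finsupp.single (Sum.inl n) 1
noncomputable def eb (n : ℤ) : Wp := Finsupp.single (Sum.inr n) 1

/-- Structure constants of W_p. -/
noncomputable def br0 : (ℤ ⊕ ℤ) → (ℤ ⊕ ℤ) → Wp
  | .inl m, .inl n => ((m : ℂ) - n) • ((4 : ℂ) • db (m + n + 1) + db (m + n + 2))
  | .inl m, .inr n => (4 * (m : ℂ) - 4 * n + 2) • eb (m + n + 1) +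
      ((m : ℂ) - n + 1) • eb (m + n + 2)
  | .inr m, .inl n => -((4 * (n : ℂ) - 4 * m + 2) • eb (n + m + 1) +
      ((n : ℂ) - m + 1) • eb (n + m + 2))
  | .inr m, .inr n => ((m : ℂ) - n) • db (m + n)

/-- The bracket of W_p, the bilinear extension of `br0`. -/
noncomputable def wbr (x y : Wp) : Wp :=
  x.sum fun i a => y.sum fun j b => (a * b) • br0 i j

/-- Images of the basis elements: d_n ↦ -p(t) t^{n+1} d/dt, which in the
variable s is (s^{-n-1} + 4 s^{-n}) d/ds; e_n ↦ -u t^{n+1} d/dt, which is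
s^{1-n} u(s) d/ds. -/
noncomputable def img : (ℤ ⊕ ℤ) → LaurentSeries ℂ
  | .inl n => HahnSeries.single (-n - 1 : ℤ) (1 : ℂ) +
      4 * HahnSeries.single (-n : ℤ) (1 : ℂ)
  | .inr n => HahnSeries.single (-n + 1 : ℤ) (1 : ℂ) * uInf

/-- The linear extension of `img` to W_p. -/
noncomputable def phi (x : Wp) : LaurentSeries ℂ := x.sum fun i a => a • img i

/-- The Euler operator `s d/ds` on Laurent series. -/
noncomputable def euler (F : LaurentSeries ℂ) : LaurentSeries ℂ where
  coeff k := (k : ℂ) * F.coeff k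
  isPWO_support' := F.isPWO_support.mono fun k hk h0 => hk (by simp [h0])

@[simp]
theorem coeff_euler (F : LaurentSeries ℂ) (k : ℤ) : (euler F).coeff k = k * F.coeff k := rfl

theorem support_euler_subset (F : LaurentSeries ℂ) : (euler F).support ⊆ F.support :=
  fun k hk h0 => hk (by simp [h0])

theorem euler_add (F G : LaurentSeries ℂ) : euler (F + G) = euler F + euler G := by
  ext k
  simp [mul_add]

theorem euler_smul (c : ℂ) (F : LaurentSeries ℂ) : euler (c • F) = c • euler F := by
  ext k
  simp [mul_left_comm]

theorem smul_eq_C_mul (c : ℂ) (F : LaurentSeries ℂ) : c • F = HahnSeries.C c * F := by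
  ext k
  simp

theorem euler_mul (F G : LaurentSeries ℂ) : euler (F * G) = euler F * G + F * euler G := by
  ext k
  rw [coeff_euler, HahnSeries.coeff_add,
    HahnSeries.coeff_mul_left' F.isPWO_support (support_euler_subset F),
    HahnSeries.coeff_mul_right' G.isPWO_support (support_euler_subset G),
    HahnSeries.coeff_mul, Finset.mul_sum, ← Finset.sum_add_distrib]
  refine Finset.sum_congr rfl fun ij hij => ?_
  rw [Finset.mem_antidiagonal] at hij
  rw [← hij.2.2, coeff_euler, coeff_euler]
  push_cast
  ring

theorem euler_single (n : ℤ) (a : ℂ) :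
    euler (HahnSeries.single n a) = (n : LaurentSeries ℂ) * HahnSeries.single n a := by
  ext k
  rw [← zsmul_eq_mul, HahnSeries.coeff_smul, coeff_euler]
  by_cases h : k = n <;> simp [h]

theorem lderiv_eq (F : LaurentSeries ℂ) :
    lderiv F = HahnSeries.single (-1 : ℤ) (1 : ℂ) * euler F := by
  ext k
  rw [HahnSeries.coeff_single_mul]
  simp [lderiv]

/-- `lderiv` as a linear map. -/
noncomputable def lderivLinear : LaurentSeries ℂ →ₗ[ℂ] LaurentSeries ℂ where
  toFun := lderiv
  map_add' F G := by simp [lderiv_eq, euler_add, mul_add]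
  map_smul' c F := by
    rw [RingHom.id_apply, lderiv_eq, lderiv_eq, euler_smul, smul_eq_C_mul, smul_eq_C_mul]
    ring

theorem lam_eq_choose (n : ℕ) : lam n = Ring.choose (1 / 2 : ℂ) n := by
  rw [Ring.choose_eq_smul, lam, div_eq_inv_mul, smul_eq_mul]
  congr 1
  induction n with
  | zero => simp
  | succ n ih =>
    rw [Finset.prod_range_succ, ih, descPochhammer_succ_right, Polynomial.smeval_mul,
      Polynomial.smeval_sub, Polynomial.smeval_X, Polynomial.smeval_natCast]
    simp

theorem powerSeries_lam_sq :
    (PowerSeries.mk fun i => lam i * 4 ^ i : PowerSeries ℂ) ^ 2 = 1 + 4 * PowerSeries.X := by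
  have h : (PowerSeries.mk fun i => lam i * 4 ^ i : PowerSeries ℂ) =
      PowerSeries.rescale 4 (PowerSeries.binomialSeries ℂ (1 / 2 : ℂ)) := by
    ext n
    simp [lam_eq_choose, mul_comm]
  have h1 : PowerSeries.binomialSeries ℂ (1 : ℂ) = 1 + PowerSeries.X := by
    simpa using PowerSeries.binomialSeries_nat (R := ℂ) (A := ℂ) 1
  rw [h, ← map_pow, sq, ← PowerSeries.binomialSeries_add, add_halves, h1, map_add, map_one,
    PowerSeries.rescale_X, map_ofNat]

/-- The variable `s = t⁻¹`. -/
noncomputable def sVar : LaurentSeries ℂ := HahnSeries.single (1 : ℤ) (1 : ℂ)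

theorem sVar_ne_zero : sVar ≠ 0 := by simp [sVar]

theorem single_eq_zpow (n : ℤ) : HahnSeries.single n (1 : ℂ) = sVar ^ n :=
  RatFunc.single_zpow n

theorem uInf_sq : uInf ^ 2 = sVar ^ (-2 : ℤ) + 4 * sVar ^ (-1 : ℤ) := by
  rw [uInf, mul_pow, ← map_pow (HahnSeries.ofPowerSeries ℤ ℂ), powerSeries_lam_sq, single_eq_zpow, map_add, map_mul, map_one,
    HahnSeries.ofPowerSeries_X, map_ofNat]
  have := sVar_ne_zero
  change (sVar ^ (-1 : ℤ)) ^ 2 * (1 + 4 * sVar) = _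
  field_simp

theorem one_add_four_sVar_ne_zero : 1 + 4 * sVar ≠ 0 := by
  intro h
  have := congrArg (fun F => HahnSeries.coeff F 0) h
  rw [← map_ofNat (HahnSeries.C : ℂ →+* LaurentSeries ℂ) 4] at this
  simp [sVar] at this

theorem uInf_sq_mul : sVar ^ 2 * uInf ^ 2 = 1 + 4 * sVar := by
  rw [uInf_sq]
  have := sVar_ne_zero
  field_simp

theorem uInf_ne_zero : uInf ≠ 0 := by
  intro h
  have := uInf_sq_mul
  rw [h] at this
  exact one_add_four_sVar_ne_zero (by simpa using this.symm)

theorem euler_sVar_zpow (n : ℤ) : euler (sVar ^ n) = n * sVar ^ n := by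
  rw [← single_eq_zpow, euler_single]

theorem euler_four_mul (F : LaurentSeries ℂ) : euler (4 * F) = 4 * euler F := by
  have h (G : LaurentSeries ℂ) : 4 * G = (4 : ℂ) • G := by
    rw [smul_eq_C_mul, map_ofNat]
  rw [h, h, euler_smul]

theorem uInf_mul_euler :
    uInf * euler uInf = -sVar ^ (-2 : ℤ) - 2 * sVar ^ (-1 : ℤ) := by
  have h := congrArg euler uInf_sq
  rw [sq, euler_mul, euler_add, euler_four_mul, euler_sVar_zpow, euler_sVar_zpow] at h
  push_cast at h
  have h2 : (2 : LaurentSeries ℂ) ≠ 0 := by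
    rw [← map_ofNat (HahnSeries.C : ℂ →+* LaurentSeries ℂ) 2]
    exact HahnSeries.C_ne_zero two_ne_zero
  refine mul_left_cancel₀ h2 ?_
  linear_combination h

theorem one_add_four_sVar_mul_euler :
    (1 + 4 * sVar) * euler uInf = (-1 - 2 * sVar) * uInf := by
  have h := uInf_mul_euler
  have h2 := uInf_sq_mul
  have hs := sVar_ne_zero
  have h3 : sVar ^ 2 * (uInf * euler uInf) = -1 - 2 * sVar := by
    rw [h]; field_simp
  linear_combination (-euler uInf) * h2 + uInf * h3

theorem img_inl (n : ℤ) : img (.inl n) = sVar ^ (-n - 1) + 4 * sVar ^ (-n) := by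
  simp only [img, single_eq_zpow]

theorem img_inr (n : ℤ) : img (.inr n) = sVar ^ (-n + 1) * uInf := by
  simp only [img, single_eq_zpow]

theorem phi_eq_linearCombination : phi = Finsupp.linearCombination ℂ img := by
  ext1 x
  rw [Finsupp.linearCombination_apply, phi]

theorem phi_db (n : ℤ) : phi (db n) = img (.inl n) := by
  simp [phi_eq_linearCombination, db]

theorem phi_eb (n : ℤ) : phi (eb n) = img (.inr n) := by
  simp [phi_eq_linearCombination, eb]

theorem phi_add (x y : Wp) : phi (x + y) = phi x + phi y := by
  simp [phi_eq_linearCombination]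

theorem phi_neg (x : Wp) : phi (-x) = -phi x := by
  simp [phi_eq_linearCombination]

theorem phi_smul (c : ℂ) (x : Wp) : phi (c • x) = (HahnSeries.C : ℂ →+* LaurentSeries ℂ) c * phi x := by
  rw [phi_eq_linearCombination, map_smul, smul_eq_C_mul]

theorem bracket_inl_inl (m n : ℤ) :
    phi (br0 (.inl m) (.inl n)) =
      img (.inl m) * lderiv (img (.inl n)) - img (.inl n) * lderiv (img (.inl m)) := by
  have hs := sVar_ne_zero
  simp only [br0, phi_smul, phi_add, phi_db, lderiv_eq, img_inl, euler_add, euler_four_mul,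
    euler_sVar_zpow, single_eq_zpow, map_sub, map_intCast, map_ofNat]
  simp only [neg_add, sub_eq_add_neg, zpow_add₀ hs]
  generalize sVar ^ (-m) = X
  generalize sVar ^ (-n) = Y
  push_cast
  field_simp
  ring

theorem bracket_inl_inr (m n : ℤ) :
    phi (br0 (.inl m) (.inr n)) =
      img (.inl m) * lderiv (img (.inr n)) - img (.inr n) * lderiv (img (.inl m)) := by
  have hs := sVar_ne_zero
  simp only [br0, phi_smul, phi_add, phi_eb, lderiv_eq, img_inl, img_inr, euler_add, euler_four_mul,
    euler_sVar_zpow, single_eq_zpow, map_sub, map_add, map_mul, map_one,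
    map_intCast, map_ofNat]
  have h := one_add_four_sVar_mul_euler
  simp only [euler_mul, euler_sVar_zpow, neg_add, sub_eq_add_neg, zpow_add₀ hs]
  generalize sVar ^ (-m) = X
  generalize sVar ^ (-n) = Y
  push_cast
  field_simp
  linear_combination (-X * Y) * h

theorem bracket_inr_inr (m n : ℤ) :
    phi (br0 (.inr m) (.inr n)) =
      img (.inr m) * lderiv (img (.inr n)) - img (.inr n) * lderiv (img (.inr m)) := by
  have hs := sVar_ne_zero
  simp only [br0, phi_smul, phi_db, lderiv_eq, img_inl, img_inr, euler_mul,
    euler_sVar_zpow, single_eq_zpow, map_sub, map_intCast]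
  have h := uInf_sq_mul
  simp only [neg_add, sub_eq_add_neg, zpow_add₀ hs]
  generalize sVar ^ (-m) = X
  generalize sVar ^ (-n) = Y
  push_cast
  field_simp
  linear_combination (-X * Y) * (m - n) * h

theorem phi_br0 (i j : ℤ ⊕ ℤ) :
    phi (br0 i j) = img i * lderiv (img j) - img j * lderiv (img i) := by
  rcases i with m | m <;> rcases j with n | n
  · exact bracket_inl_inl m n
  · exact bracket_inl_inr m n
  · have h : br0 (.inr m) (.inl n) = -br0 (.inl n) (.inr m) := rfl
    rw [h, phi_neg, bracket_inl_inr, neg_sub]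
  · exact bracket_inr_inr m n

theorem phi_wbr (x y : Wp) :
    phi (wbr x y) = phi x * lderiv (phi y) - phi y * lderiv (phi x) := by
  have hL (z : Wp) : lderiv (phi z) = z.sum fun i a => a • lderiv (img i) := by
    change lderivLinear (z.sum fun i a => a • img i) = _
    rw [map_finsuppSum]
    simp only [map_smul]
    rfl
  rw [hL, hL, mul_comm (phi y), wbr, phi_eq_linearCombination, map_finsuppSum]
  simp only [map_finsuppSum, map_smul, ← phi_eq_linearCombination, phi_br0]
  simp only [phi, Finsupp.sum, Finset.sum_mul_sum, ← Finset.sum_sub_distrib]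
  refine Finset.sum_congr rfl fun i _ => Finset.sum_congr rfl fun j _ => ?_
  simp only [smul_eq_C_mul, map_mul]
  ring

/-- The Laurent polynomial `∑ cₙ tⁿ`, as an element of `ℂ((t⁻¹))`. -/
noncomputable def laurentSum (c : ℤ →₀ ℂ) : LaurentSeries ℂ :=
  Finsupp.linearCombination ℂ (fun n : ℤ => sVar ^ (-n)) c

theorem laurentSum_coeff (c : ℤ →₀ ℂ) (k : ℤ) : (laurentSum c).coeff (-k) = c k := by
  induction c using Finsupp.induction_linear with
  | zero => simp [laurentSum]
  | add f g hf hg => simp_all [laurentSum]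
  | single n a =>
    simp [laurentSum, ← single_eq_zpow, HahnSeries.coeff_single, Finsupp.single_apply, eq_comm]

theorem laurentSum_eq_zero {c : ℤ →₀ ℂ} (h : laurentSum c = 0) : c = 0 := by
  ext k
  rw [← laurentSum_coeff, h]
  simp

/-- The embedding of polynomials in `s` into Laurent series. -/
noncomputable def polyEmb : Polynomial ℂ →+* LaurentSeries ℂ :=
  (HahnSeries.ofPowerSeries ℤ ℂ).comp Polynomial.coeToPowerSeries.ringHom

theorem polyEmb_injective : Function.Injective polyEmb :=
  HahnSeries.ofPowerSeries_injective.comp (Polynomial.coe_injective ℂ)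

theorem polyEmb_X : polyEmb Polynomial.X = sVar := by
  simp [polyEmb, sVar]

theorem polyEmb_C (a : ℂ) : polyEmb (Polynomial.C a) = (HahnSeries.C : ℂ →+* LaurentSeries ℂ) a := by
  simp [polyEmb]

theorem exists_polyEmb_eq (c : ℤ →₀ ℂ) :
    ∃ (N : ℕ) (q : Polynomial ℂ), polyEmb q = sVar ^ N * laurentSum c := by
  have hs := sVar_ne_zero
  induction c using Finsupp.induction_linear with
  | zero => exact ⟨0, 0, by simp [laurentSum]⟩
  | add f g hf hg =>
    obtain ⟨N, p, hp⟩ := hf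
    obtain ⟨M, q, hq⟩ := hg
    refine ⟨N + M, Polynomial.X ^ M * p + Polynomial.X ^ N * q, ?_⟩
    have : laurentSum (f + g) = laurentSum f + laurentSum g := map_add _ _ _
    rw [this, map_add, map_mul, map_mul, map_pow, map_pow, polyEmb_X, hp, hq]
    ring
  | single n a =>
    refine ⟨n.toNat, Polynomial.C a * Polynomial.X ^ (-n).toNat, ?_⟩
    rw [map_mul, map_pow, polyEmb_X, polyEmb_C, laurentSum, Finsupp.linearCombination_single,
      smul_eq_C_mul, mul_left_comm, ← zpow_natCast, ← zpow_natCast, ← zpow_add₀ hs]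
    congr 2
    omega

theorem eq_zero_of_polynomial_identity {A B : Polynomial ℂ} {M N : ℕ}
    (h : (1 + 4 * Polynomial.X) * (Polynomial.X ^ M * A) ^ 2 = (Polynomial.X ^ N * B) ^ 2) :
    A = 0 := by
  by_contra hA
  have hd : (1 + 4 * Polynomial.X : Polynomial ℂ).natDegree = 1 := by
    rw [add_comm]
    exact Polynomial.natDegree_linear (a := (4 : ℂ)) (b := 1) (by norm_num)
  have hP : (Polynomial.X ^ M * A) ≠ 0 := mul_ne_zero (by simp) hA
  have h1 := congrArg Polynomial.natDegree h
  rw [Polynomial.natDegree_mul (fun h0 => by simp [h0] at hd) (pow_ne_zero 2 hP), hd,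
    Polynomial.natDegree_pow, Polynomial.natDegree_pow] at h1
  omega

theorem laurentSum_independent {a b : ℤ →₀ ℂ}
    (h : (1 + 4 * sVar) * laurentSum a ^ 2 = sVar ^ 2 * laurentSum b ^ 2) : a = 0 := by
  obtain ⟨M, A, hA⟩ := exists_polyEmb_eq a
  obtain ⟨N, B, hB⟩ := exists_polyEmb_eq b
  have hA0 : A = 0 := by
    refine eq_zero_of_polynomial_identity (B := B) (M := N) (N := M + 1) (polyEmb_injective ?_)
    simp only [map_mul, map_pow, map_add, map_one, map_ofNat, polyEmb_X, hA, hB]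
    linear_combination (sVar ^ (N + M)) ^ 2 * h
  rw [hA0, map_zero] at hA
  exact laurentSum_eq_zero ((mul_eq_zero.mp hA.symm).resolve_left (pow_ne_zero _ sVar_ne_zero))

theorem phi_eq_laurentSum (x : Wp) :
    phi x = sVar ^ (-1 : ℤ) * (1 + 4 * sVar) *
        laurentSum (Finsupp.sumFinsuppLEquivProdFinsupp ℂ x).1 +
      sVar * uInf * laurentSum (Finsupp.sumFinsuppLEquivProdFinsupp ℂ x).2 := by
  have hs := sVar_ne_zero
  have hadd (f g : ℤ →₀ ℂ) : laurentSum (f + g) = laurentSum f + laurentSum g := map_add _ _ _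
  induction x using Finsupp.induction_linear with
  | zero => simp [phi, laurentSum]
  | add x y hx hy =>
    rw [phi_add, hx, hy, map_add, Prod.fst_add, Prod.snd_add, hadd, hadd]
    ring
  | single i a =>
    rcases i with n | n
    · have h : Finsupp.sumFinsuppLEquivProdFinsupp ℂ (Finsupp.single (Sum.inl n : ℤ ⊕ ℤ) a) =
          (Finsupp.single n a, 0) := by
        ext k <;> simp [Finsupp.sumFinsuppLEquivProdFinsupp, Finsupp.single_apply]
      simp only [h, phi_eq_linearCombination, laurentSum, Finsupp.linearCombination_single,
        map_zero, smul_eq_C_mul, img_inl, sub_eq_add_neg, zpow_add₀ hs]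
      field_simp
      ring
    · have h : Finsupp.sumFinsuppLEquivProdFinsupp ℂ (Finsupp.single (Sum.inr n : ℤ ⊕ ℤ) a) =
          (0, Finsupp.single n a) := by
        ext k <;> simp [Finsupp.sumFinsuppLEquivProdFinsupp, Finsupp.single_apply]
      simp only [h, phi_eq_linearCombination, laurentSum, Finsupp.linearCombination_single,
        map_zero, smul_eq_C_mul, img_inr, zpow_add₀ hs, zpow_one]
      ring

theorem eq_zero_of_phi_eq_zero {x : Wp} (hx : phi x = 0) : x = 0 := by
  have hs := sVar_ne_zero
  rw [phi_eq_laurentSum] at hx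
  set y := Finsupp.sumFinsuppLEquivProdFinsupp ℂ x with hy
  have h1 : (1 + 4 * sVar) * laurentSum y.1 = -(sVar ^ 2 * uInf * laurentSum y.2) := by
    field_simp at hx
    linear_combination hx
  have ha : y.1 = 0 := by
    refine laurentSum_independent (b := y.2)
      (mul_left_cancel₀ one_add_four_sVar_ne_zero ?_)
    have h2 := uInf_sq_mul
    linear_combination ((1 + 4 * sVar) * laurentSum y.1 - sVar ^ 2 * uInf * laurentSum y.2) * h1
      + sVar ^ 2 * laurentSum y.2 ^ 2 * h2
  have hb : y.2 = 0 := by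
    apply laurentSum_eq_zero
    rw [ha] at h1
    simpa [laurentSum, uInf_ne_zero, hs] using h1
  exact (LinearEquiv.map_eq_zero_iff _).mp (hy.symm.trans (Prod.ext ha hb))

/-- φ : W_p → Der ℂ((t⁻¹)), d_n ↦ -p(t)t^{n+1} d/dt, e_n ↦ -u t^{n+1} d/dt,
is an injective homomorphism of Lie algebras. -/
theorem phi_injective_lieHom :
    (∀ x y : Wp, phi (wbr x y) = phi x * lderiv (phi y) - phi y * lderiv (phi x)) ∧
    Function.Injective phi := by
  refine ⟨phi_wbr, fun x y hxy => sub_eq_zero.mp (eq_zero_of_phi_eq_zero ?_)⟩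
  rw [sub_eq_add_neg, phi_add, phi_neg, hxy, add_neg_cancel]
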